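/- arXiv:2403.08087 — 3 statements merged into one kernel-verified Lean document; each statement's English description precedes it below -/
import Mathlib

section
/- N_+ is internally projective in the topos of difference sets: for every surjective difference morphism q : Y → Z and every ladder (g_i)_{i∈ℕ} from N_+ to Z, there exists a ladder (f_i)_{i∈ℕ} from N_+ to Y with q ∘ f_i = g_i for all i. -/
/-- The ladder from `N₊` with prescribed values `s i j` on the boundary `i = 0` or `j = 0`,
extended along the diagonals by `σ`. -/
def ladderOfBoundary {Y : Type*} (σ : Y → Y) (s : ℕ → ℕ → Y) : ℕ → ℕ → Y
  | 0, j => s 0 j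
  | i + 1, 0 => s (i + 1) 0
  | i + 1, j + 1 => σ (ladderOfBoundary σ s i j)


/-- `N₊ = (ℕ, ·+1)` is internally projective in the topos of difference
sets: for every surjective difference morphism `q : (Y,σY) → (Z,σZ)` and every ladder
`(gᵢ)` from `N₊` to `Z`, there is a ladder `(fᵢ)` from `N₊` to `Y` with `q ∘ fᵢ = gᵢ`. -/
theorem Nplus_internally_projective (Y Z : Type*) (σY : Y → Y) (σZ : Z → Z)
    (q : Y → Z) (hq : Function.Surjective q) (hqd : ∀ y, q (σY y) = σZ (q y))
    (g : ℕ → ℕ → Z) (hg : ∀ i j, g (i + 1) (j + 1) = σZ (g i j)) :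
    ∃ f : ℕ → ℕ → Y,
      (∀ i j, f (i + 1) (j + 1) = σY (f i j)) ∧ ∀ i j, q (f i j) = g i j := by
  choose s hs using hq
  refine ⟨ladderOfBoundary σY fun i j => s (g i j), fun _ _ => rfl, fun i => ?_⟩
  induction i with
  | zero => exact fun j => hs _
  | succ i ih =>
    rintro (_ | j)
    · exact hs _
    · rw [ladderOfBoundary, hqd, ih, hg]
end

section
/- For every set X, the difference k-module ⌈X|⊗k is internally projective: for every surjective morphism q : Y → Z of difference k-modules and every ladder (g_j)_{j∈ℕ} from ⌈X|⊗k to Z, there exists a ladder (f_j)_{j∈ℕ} from ⌈X|⊗k to Y with q ∘ f_j = g_j for all j. -/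
/-- The endomorphism of the free difference `k`-module `⌈X|⊗k = ⊕_{(x,i) ∈ X×ℕ} k`,
sending `λ·e_{(x,i)}` to `σk(λ)·e_{(x,i+1)}`. -/
noncomputable def sigmaFree (k : Type*) [CommRing k] (σk : k →+* k) (X : Type*)
    (v : (X × ℕ) →₀ k) : (X × ℕ) →₀ k :=
  Finsupp.mapDomain (fun p => (p.1, p.2 + 1)) (Finsupp.mapRange σk σk.map_zero v)

theorem sigmaFree_zero (k : Type*) [CommRing k] (σk : k →+* k) (X : Type*) :
    sigmaFree k σk X 0 = 0 := by
  simp [sigmaFree]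

theorem sigmaFree_add (k : Type*) [CommRing k] (σk : k →+* k) (X : Type*)
    (v w : (X × ℕ) →₀ k) :
    sigmaFree k σk X (v + w) = sigmaFree k σk X v + sigmaFree k σk X w := by
  rw [sigmaFree, Finsupp.mapRange_add (fun a b => map_add σk a b), Finsupp.mapDomain_add]
  rfl

theorem sigmaFree_single (k : Type*) [CommRing k] (σk : k →+* k) (X : Type*)
    (x : X) (i : ℕ) (c : k) :
    sigmaFree k σk X (Finsupp.single (x, i) c) = Finsupp.single (x, i + 1) (σk c) := by
  simp [sigmaFree, Finsupp.mapDomain_single]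

/-- The extension along the diagonals of `ℕ × ℕ`, by iterating `σ`, of the values that `b` takes
on the two axes. -/
def diagonalExtension {Y : Type*} (σ : Y → Y) (b : ℕ → ℕ → Y) : ℕ → ℕ → Y
  | 0, i => b 0 i
  | j + 1, 0 => b (j + 1) 0
  | j + 1, i + 1 => σ (diagonalExtension σ b j i)

theorem map_diagonalExtension {Y Z : Type*} (σY : Y → Y) (σZ : Z → Z) (q : Y → Z)
    (hqd : ∀ y, q (σY y) = σZ (q y)) (b : ℕ → ℕ → Y) (c : ℕ → ℕ → Z)
    (hb : ∀ j i, q (b j i) = c j i) (hc : ∀ j i, c (j + 1) (i + 1) = σZ (c j i)) (j i : ℕ) :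
    q (diagonalExtension σY b j i) = c j i := by
  induction j generalizing i with
  | zero => exact hb 0 i
  | succ j ih =>
    cases i with
    | zero => exact hb (j + 1) 0
    | succ i => rw [diagonalExtension, hqd, ih, hc]

/-- For every set `X`, the difference `k`-module `⌈X|⊗k` is internally
projective: for every surjective morphism `q : Y → Z` of difference `k`-modules and every
ladder `(gⱼ)` from `⌈X|⊗k` to `Z`, there is a ladder `(fⱼ)` from `⌈X|⊗k` to `Y` with
`q ∘ fⱼ = gⱼ` for all `j`. -/
theorem free_internally_projective (k : Type*) [CommRing k] (σk : k →+* k) (X : Type*)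
    (Y Z : Type*) [AddCommGroup Y] [Module k Y] [AddCommGroup Z] [Module k Z]
    (σY : Y →ₛₗ[σk] Y) (σZ : Z →ₛₗ[σk] Z)
    (q : Y →ₗ[k] Z) (hq : Function.Surjective q) (hqd : ∀ y, q (σY y) = σZ (q y))
    (g : ℕ → ((X × ℕ) →₀ k) →ₗ[k] Z)
    (hg : ∀ j v, g (j + 1) (sigmaFree k σk X v) = σZ (g j v)) :
    ∃ f : ℕ → ((X × ℕ) →₀ k) →ₗ[k] Y,
      (∀ j v, f (j + 1) (sigmaFree k σk X v) = σY (f j v)) ∧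
      ∀ j, q.comp (f j) = g j := by
  choose s hs using hq
  let F : ℕ → X × ℕ → Y := fun j p =>
    diagonalExtension σY (fun j i => s (g j (Finsupp.single (p.1, i) 1))) j p.2
  have hF : ∀ j p, q (F j p) = g j (Finsupp.single p 1) := fun j p =>
    map_diagonalExtension σY σZ q hqd _ (fun j i => g j (Finsupp.single (p.1, i) 1))
      (fun j i => hs _)
      (fun j i => by rw [← hg, sigmaFree_single, map_one]) j p.2
  refine ⟨fun j => Finsupp.linearCombination k (F j), fun j v => ?_, fun j => ?_⟩
  · induction v using Finsupp.induction_linear with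
    | zero => simp [sigmaFree_zero]
    | add v w hv hw => rw [sigmaFree_add, map_add, hv, hw, map_add, map_add]
    | single p c =>
      rw [sigmaFree_single, Finsupp.linearCombination_single, Finsupp.linearCombination_single,
        map_smulₛₗ]
      rfl
  · ext p
    simp [hF]
end

section
/- The kernel of f equals the image of g: for the k{x,y}-linear maps f : ⊕_{i∈ℕ} k{x,y} → k{x,y}, f(e_i·p) = z_i·p, and g : ⊕_{(i,j)∈ℕ×ℕ} k{x,y} → ⊕_{i∈ℕ} k{x,y}, g(e_{(i,j)}·p) = e_i·(z_j·p) − e_j·(z_i·p), one has ker f = range g. -/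
/-- `z i = x i - y i` in `k{x,y} = MvPolynomial (ℕ ⊕ ℕ) k`. -/
noncomputable def zVar (k : Type*) [CommRing k] (i : ℕ) : MvPolynomial (ℕ ⊕ ℕ) k :=
  MvPolynomial.X (Sum.inl i) - MvPolynomial.X (Sum.inr i)

section Koszul

variable {R ι : Type*} [CommRing R]

/-- The first Koszul differential `e_{(i,j)} ↦ z j • e i - z i • e j` of a family `z`. -/
noncomputable def koszulMap (z : ι → R) : (ι × ι →₀ R) →ₗ[R] (ι →₀ R) :=
  Finsupp.linearCombination R
    (fun ij : ι × ι => Finsupp.single ij.1 (z ij.2) - Finsupp.single ij.2 (z ij.1))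

theorem linearCombination_koszulMap (z : ι → R) (b : ι × ι →₀ R) :
    Finsupp.linearCombination R z (koszulMap z b) = 0 := by
  induction b using Finsupp.induction_linear with
  | zero => simp
  | add b c hb hc => rw [map_add, map_add, hb, hc, add_zero]
  | single ij r => simp [koszulMap, mul_comm]

theorem single_linearCombination_sub_smul_mem_range_koszulMap (z : ι → R) (i : ι) (l : ι →₀ R) :
    Finsupp.single i (Finsupp.linearCombination R z l) - z i • l ∈
      LinearMap.range (koszulMap z) := by
  induction l using Finsupp.induction_linear with
  | zero => simp
  | add b c hb hc =>
    convert add_mem hb hc using 1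
    rw [map_add, Finsupp.single_add, smul_add]
    abel
  | single j r =>
    refine ⟨Finsupp.single (i, j) r, ?_⟩
    simp [koszulMap, smul_sub, mul_comm]

/-- The first Koszul homology of a weakly regular sequence vanishes. -/
theorem ker_linearCombination_eq_range_koszulMap (z : ℕ → R)
    (hz : ∀ n a, z n * a ∈ Ideal.span (z '' Set.Iio n) → a ∈ Ideal.span (z '' Set.Iio n)) :
    LinearMap.ker (Finsupp.linearCombination R z) = LinearMap.range (koszulMap z) := by
  refine le_antisymm (fun a ha => ?_) ?_
  · have key : ∀ n, ∀ a ∈ Finsupp.supported R R (Set.Iio n),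
        Finsupp.linearCombination R z a = 0 → a ∈ LinearMap.range (koszulMap z) := by
      intro n
      induction n with
      | zero =>
        intro a ha _
        have : a = 0 := by
          ext i
          exact (Finsupp.mem_supported' R a).1 ha i (by simp)
        rw [this]
        exact zero_mem _
      | succ n ih =>
        intro a ha h0
        rw [Finsupp.mem_supported'] at ha
        have herase : a.erase n ∈ Finsupp.supported R R (Set.Iio n) := by
          rw [Finsupp.mem_supported']
          intro i hi
          rcases eq_or_ne i n with rfl | hne
          · simp
          · rw [Finsupp.erase_ne hne]
            exact ha i (by simp at hi ⊢; omega)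
        have hsum : a n * z n + Finsupp.linearCombination R z (a.erase n) = 0 := by
          rw [← h0]
          conv_rhs => rw [← Finsupp.single_add_erase n a]
          rw [map_add, Finsupp.linearCombination_single, smul_eq_mul]
        have hmem : a n ∈ Ideal.span (z '' Set.Iio n) := by
          apply hz
          rw [mul_comm, eq_neg_of_add_eq_zero_left hsum]
          exact neg_mem ((Finsupp.mem_span_image_iff_linearCombination R).2 ⟨_, herase, rfl⟩)
        obtain ⟨l, hl, hla⟩ := (Finsupp.mem_span_image_iff_linearCombination R).1 hmem
        have hrange := single_linearCombination_sub_smul_mem_range_koszulMap z n l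
        have hdecomp : a = (Finsupp.single n (Finsupp.linearCombination R z l) - z n • l) +
            (a.erase n + z n • l) := by
          conv_lhs => rw [← Finsupp.single_add_erase n a]
          rw [hla]
          abel
        rw [hdecomp]
        refine add_mem hrange (ih _ (add_mem herase (Submodule.smul_mem _ _ hl)) ?_)
        rw [map_add, map_smul, hla, smul_eq_mul, mul_comm, add_comm, hsum]
    refine key (a.support.sup id + 1) a ?_ ha
    intro i hi
    exact Nat.lt_succ_of_le (Finset.le_sup (f := id) hi)
  · rintro _ ⟨b, rfl⟩
    exact linearCombination_koszulMap z b

end Koszul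

open MvPolynomial in
theorem isRegular_X_sub_X {σ k : Type*} [CommRing k] {s t : σ} (hst : s ≠ t) :
    IsRegular (X s - X t : MvPolynomial σ k) := by
  classical
  let T : MvPolynomial σ k →ₐ[k] MvPolynomial σ k := aeval (Function.update X s (X s + X t))
  let U : MvPolynomial σ k →ₐ[k] MvPolynomial σ k := aeval (Function.update X s (X s - X t))
  have hUT : U.comp T = AlgHom.id k _ := by
    ext1 i
    rcases eq_or_ne i s with rfl | hi
    · simp [T, U, hst.symm]
    · simp [T, U, hi]
  have hT : Function.Injective T :=
    Function.LeftInverse.injective (g := U) fun p => DFunLike.congr_fun hUT p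
  rw [← isLeftRegular_iff_isRegular]
  intro p q hpq
  apply hT
  have h := congrArg T hpq
  simp only [map_mul] at h
  have hTz : T (X s - X t) = X s := by simp [T, hst.symm]
  rw [hTz] at h
  exact (isRegular_X (R := k) (n := s)).left h

open MvPolynomial in
theorem mem_span_zVar_of_mul_mem (k : Type*) [CommRing k] (n : ℕ) (a : MvPolynomial (ℕ ⊕ ℕ) k)
    (h : zVar k n * a ∈ Ideal.span (zVar k '' Set.Iio n)) :
    a ∈ Ideal.span (zVar k '' Set.Iio n) := by
  set I := Ideal.span (zVar k '' Set.Iio n)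
  let φ : MvPolynomial (ℕ ⊕ ℕ) k →ₐ[k] MvPolynomial (ℕ ⊕ ℕ) k :=
    aeval (Sum.elim (fun i => if i < n then X (Sum.inr i) else X (Sum.inl i))
      (fun i => X (Sum.inr i)))
  have hφ : (Ideal.Quotient.mkₐ k I).comp φ = Ideal.Quotient.mkₐ k I := by
    ext1 i
    rcases i with i | i
    · by_cases hi : i < n
      · simp only [φ, AlgHom.comp_apply, aeval_X, Sum.elim_inl, if_pos hi,
          Ideal.Quotient.mkₐ_eq_mk]
        refine (Ideal.Quotient.eq.2 ?_).symm
        exact Ideal.subset_span ⟨i, hi, rfl⟩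
      · simp [φ, hi]
    · simp [φ]
  have hker : I ≤ RingHom.ker φ := by
    refine Ideal.span_le.2 ?_
    rintro _ ⟨i, hi, rfl⟩
    have hi : i < n := hi
    simp [φ, zVar, RingHom.mem_ker, hi]
  have hzero : zVar k n * φ a = 0 := by
    have h1 : φ (zVar k n * a) = 0 := hker h
    have h2 : φ (zVar k n) = zVar k n := by simp [φ, zVar]
    rwa [map_mul, h2] at h1
  have hreg : IsRegular (zVar k n) := isRegular_X_sub_X Sum.inl_ne_inr
  have hφa : φ a = 0 := hreg.left (by simpa using hzero)
  have h3 := DFunLike.congr_fun hφ a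
  rw [AlgHom.comp_apply, hφa, map_zero] at h3
  exact Ideal.Quotient.eq_zero_iff_mem.1 h3.symm

/-- For the `k{x,y}`-linear maps `f : ⊕_{i∈ℕ} k{x,y} → k{x,y}`,
`f(eᵢ·p) = zᵢ·p`, and `g : ⊕_{(i,j)} k{x,y} → ⊕_i k{x,y}`,
`g(e_{(i,j)}·p) = eᵢ·(zⱼ·p) − eⱼ·(zᵢ·p)`, one has `ker f = range g`. -/
theorem ker_f_eq_range_g (k : Type*) [CommRing k] :
    LinearMap.ker
        (Finsupp.linearCombination (MvPolynomial (ℕ ⊕ ℕ) k) (zVar k)) =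
      LinearMap.range
        (Finsupp.linearCombination (MvPolynomial (ℕ ⊕ ℕ) k)
          (fun ij : ℕ × ℕ =>
            Finsupp.single ij.1 (zVar k ij.2) - Finsupp.single ij.2 (zVar k ij.1))) := by
  exact ker_linearCombination_eq_range_koszulMap (zVar k) (mem_span_zVar_of_mul_mem k)
end
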